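/- Let 𝒞 = {(x,y,z) ∈ ℝ³ : x² + y² < 1, z ≥ 0} be the open half-infinite cylinder of radius 1 over the upper half-space. There is no 1-constrained arc γ : [0,s] → 𝒞 that simultaneously satisfies: (1) γ(0) and γ(s) both lie on the xy-plane (z = 0); and (2) there exists a sphere S of radius 1 centered at a point on the negative z-axis with γ(0), γ(s) ∈ S and some point of the image of γ lying strictly above S. -/

import Mathlib

open Set Metric

noncomputable section

/-- ℝ³ as a Euclidean space. -/
abbrev E3 : Type := EuclideanSpace ℝ (Fin 3)

/-- `γ : [0,s] → ℝ³` is a κ-constrained curve: arclength-parametrized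
(unit speed), `C¹` and piecewise `C²`, with `‖γ''(t)‖ ≤ κ` wherever the second
derivative is defined (i.e. away from a finite set of break points). -/
structure IsKConstrained (κ s : ℝ) (γ : ℝ → E3) : Prop where
  s_pos : 0 < s
  contDiff : ContDiffOn ℝ 1 γ (Icc 0 s)
  unitSpeed : ∀ t ∈ Icc 0 s, ‖derivWithin γ (Icc 0 s) t‖ = 1
  piecewiseC2 : ∃ F : Finset ℝ, ∀ t ∈ Icc 0 s, t ∉ F →
    ∃ d : E3, HasDerivWithinAt (fun u => derivWithin γ (Icc 0 s) u) d (Icc 0 s) t ∧ ‖d‖ ≤ κ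

/-- A 1-constrained arc: an embedded κ-constrained curve with κ = 1 and
distinct endpoints. -/
def IsOneConstrainedArc (s : ℝ) (γ : ℝ → E3) : Prop :=
  IsKConstrained 1 s γ ∧ InjOn γ (Icc 0 s) ∧ γ 0 ≠ γ s

/-- A point `p` lies (strictly) above the radius-1 sphere centered at `c`:
the vertical line through `p` meets the sphere, and the z-coordinate of `p`
strictly exceeds that of the corresponding (upper) point of the sphere;
in particular `p` lies outside the sphere. -/
def AboveSphere (c p : E3) : Prop :=
  (p 0 - c 0) ^ 2 + (p 1 - c 1) ^ 2 ≤ 1 ∧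
  c 2 + Real.sqrt (1 - ((p 0 - c 0) ^ 2 + (p 1 - c 1) ^ 2)) < p 2

/-- The open half-infinite cylinder of radius 1 over the upper half-space:
`𝒞 = {(x,y,z) : x² + y² < 1, z ≥ 0}`. -/
def Cyl : Set E3 := {p | (p 0) ^ 2 + (p 1) ^ 2 < 1 ∧ 0 ≤ p 2}

theorem aux_mono (F : Finset ℝ) : ∀ (a b : ℝ) (h : ℝ → ℝ), a ≤ b → ContinuousOn h (Icc a b) →
    (∀ t ∈ Ioo a b, t ∉ F → ∃ d, HasDerivAt h d t ∧ 0 ≤ d) → h a ≤ h b := by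
  induction F using Finset.induction_on with
  | empty =>
    intro a b h hab hc hd
    have : MonotoneOn h (Icc a b) := by
      apply monotoneOn_of_deriv_nonneg (convex_Icc a b) hc
      · intro t ht
        rw [interior_Icc] at ht
        obtain ⟨d, h1, _⟩ := hd t ht (by simp)
        exact h1.differentiableAt.differentiableWithinAt
      · intro t ht
        rw [interior_Icc] at ht
        obtain ⟨d, h1, h2⟩ := hd t ht (by simp)
        rwa [h1.deriv]
    exact this (left_mem_Icc.2 hab) (right_mem_Icc.2 hab) hab
  | insert x F hx ih =>
    intro a b h hab hc hd
    by_cases hxm : x ∈ Ioo a b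
    · have h1 : h a ≤ h x := by
        apply ih a x h hxm.1.le (hc.mono (Icc_subset_Icc_right hxm.2.le))
        intro t ht htF
        apply hd t ⟨ht.1, ht.2.trans hxm.2⟩
        simp [htF, ht.2.ne]
      have h2 : h x ≤ h b := by
        apply ih x b h hxm.2.le (hc.mono (Icc_subset_Icc_left hxm.1.le))
        intro t ht htF
        apply hd t ⟨hxm.1.trans ht.1, ht.2⟩
        simp [htF, ht.1.ne']
      exact h1.trans h2
    · apply ih a b h hab hc
      intro t ht htF
      apply hd t ht
      have : t ≠ x := by rintro rfl; exact hxm ht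
      simp [htF, this]

theorem aux_norm (p : E3) : ‖p‖ ^ 2 = p 0 ^ 2 + p 1 ^ 2 + p 2 ^ 2 := by
  rw [EuclideanSpace.norm_sq_eq, Fin.sum_univ_three]
  simp

/-- geometric obstruction. There is no 1-constrained arc in the
open cylinder `𝒞` whose endpoints lie on the xy-plane and on a radius-1 sphere `S`
centered on the negative z-axis, while some point of the arc lies strictly above `S`. -/
theorem no_oneConstrained_arc_in_cylinder_above_sphere :
    ¬ ∃ (s : ℝ) (γ : ℝ → E3), IsOneConstrainedArc s γ ∧
      γ '' Icc 0 s ⊆ Cyl ∧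
      (γ 0) 2 = 0 ∧ (γ s) 2 = 0 ∧
      ∃ c : E3, c 0 = 0 ∧ c 1 = 0 ∧ c 2 < 0 ∧
        γ 0 ∈ sphere c 1 ∧ γ s ∈ sphere c 1 ∧
        ∃ t ∈ Icc 0 s, AboveSphere c (γ t) := by
  rintro ⟨s, γ, ⟨hK, -, -⟩, hcyl, hz0, hzs, c, hc0, hc1, hc2, h0, hs, T, hT, habove⟩
  have spos := hK.s_pos
  have hγc : ContinuousOn γ (Icc 0 s) := hK.contDiff.continuousOn
  set v : ℝ → E3 := fun u => derivWithin γ (Icc 0 s) u with hv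
  have hvc : ContinuousOn v (Icc 0 s) :=
    hK.contDiff.continuousOn_derivWithin (uniqueDiffOn_Icc spos) le_rfl
  have hγd : ∀ t ∈ Ioo 0 s, HasDerivAt γ (v t) t := by
    intro t ht
    have h1 := (hK.contDiff.differentiableOn one_ne_zero t (Ioo_subset_Icc_self ht)).hasDerivWithinAt
    exact h1.hasDerivAt (Icc_mem_nhds ht.1 ht.2)
  obtain ⟨F, hF⟩ := hK.piecewiseC2
  have hcoord : ∀ i : Fin 3, ContinuousOn (fun t => γ t i) (Icc 0 s) := by
    intro i
    exact (EuclideanSpace.proj (𝕜 := ℝ) i).continuous.comp_continuousOn hγc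
  set f : ℝ → ℝ := fun t => γ t 2 - Real.sqrt (1 - ((γ t 0) ^ 2 + (γ t 1) ^ 2)) with hf
  have hfc : ContinuousOn f (Icc 0 s) := by
    apply (hcoord 2).sub
    apply ContinuousOn.sqrt
    exact continuousOn_const.sub (((hcoord 0).pow 2).add ((hcoord 1).pow 2))
  have hend : ∀ p : E3, p 2 = 0 → p ∈ sphere c 1 →
      p 2 - Real.sqrt (1 - ((p 0) ^ 2 + (p 1) ^ 2)) = c 2 := by
    intro p hp hps
    rw [mem_sphere, dist_eq_norm] at hps
    have := aux_norm (p - c)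
    rw [hps] at this
    simp [hc0, hc1, hp] at this
    have h2 : 1 - ((p 0) ^ 2 + (p 1) ^ 2) = (- c 2) ^ 2 := by linarith
    rw [h2, Real.sqrt_sq (by linarith), hp]; ring
  have hf0 : f 0 = c 2 := hend _ hz0 h0
  have hfs : f s = c 2 := hend _ hzs hs
  have hfT : c 2 < f T := by
    have := habove.2
    simp only [hc0, hc1, sub_zero] at this
    simp only [hf]; linarith
  obtain ⟨m, hm, hmax⟩ := isCompact_Icc.exists_isMaxOn (nonempty_Icc.2 spos.le) hfc
  set M := f m with hM
  have hMgt : c 2 < M := lt_of_lt_of_le hfT (hmax hT)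
  have hle : ∀ t ∈ Icc 0 s, f t ≤ M := fun t ht => hmax ht
  have hAc : IsCompact (Icc 0 s ∩ f ⁻¹' {M}) :=
    isCompact_Icc.of_isClosed_subset (hfc.preimage_isClosed_of_isClosed isClosed_Icc isClosed_singleton)
      inter_subset_left
  obtain ⟨t0, ⟨ht0, hft0⟩, hleast⟩ := hAc.exists_isLeast ⟨m, hm, rfl⟩
  have hft0 : f t0 = M := hft0
  have ht0' : t0 ∈ Ioo 0 s := by
    refine ⟨lt_of_le_of_ne ht0.1 ?_, lt_of_le_of_ne ht0.2 ?_⟩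
    · rintro rfl; linarith
    · rintro rfl; linarith
  have hr : ∀ t ∈ Icc 0 s, 0 < 1 - ((γ t 0) ^ 2 + (γ t 1) ^ 2) := by
    intro t ht
    have := (hcyl ⟨t, ht, rfl⟩).1
    linarith
  set C : E3 := !₂[0, 0, M] with hC
  have hg : ∀ t, ‖γ t - C‖ ^ 2 = (γ t 0) ^ 2 + (γ t 1) ^ 2 + (γ t 2 - M) ^ 2 := by
    intro t
    rw [aux_norm]; simp [hC]
  -- neighbourhood
  have hz : ∀ᶠ t in nhds t0, t ∈ Ioo 0 s ∧ M < γ t 2 := by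
    have hca : ContinuousAt (fun t => γ t 2) t0 :=
      (hcoord 2).continuousAt (Icc_mem_nhds ht0'.1 ht0'.2)
    have h1 : M < γ t0 2 := by
      have := Real.sqrt_pos.2 (hr t0 ht0)
      simp only [hf] at hft0; linarith
    filter_upwards [Ioo_mem_nhds ht0'.1 ht0'.2, hca.eventually (lt_mem_nhds h1)] with t h2 h3
    exact ⟨h2, h3⟩
  have hg1 : ∀ t ∈ Ioo 0 s, M < γ t 2 → ‖γ t - C‖ ^ 2 ≤ 1 := by
    intro t ht hMt
    have ht' := Ioo_subset_Icc_self ht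
    have h1 : γ t 2 - M ≤ Real.sqrt (1 - ((γ t 0) ^ 2 + (γ t 1) ^ 2)) := by
      have := hle t ht'; simp only [hf] at this; linarith
    have h2 := Real.sq_sqrt (hr t ht').le
    have h3 : (γ t 2 - M) ^ 2 ≤ Real.sqrt (1 - ((γ t 0) ^ 2 + (γ t 1) ^ 2)) ^ 2 :=
      pow_le_pow_left₀ (by linarith) h1 2
    rw [hg]; linarith
  have hgt0 : ‖γ t0 - C‖ ^ 2 = 1 := by
    have h1 : γ t0 2 - M = Real.sqrt (1 - ((γ t0 0) ^ 2 + (γ t0 1) ^ 2)) := by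
      simp only [hf] at hft0; linarith
    rw [hg, h1, Real.sq_sqrt (hr t0 ht0).le]; ring
  have hgd : ∀ t ∈ Ioo 0 s, HasDerivAt (fun t => ‖γ t - C‖ ^ 2) (2 * inner ℝ (γ t - C) (v t)) t := by
    intro t ht
    exact ((hγd t ht).sub_const C).norm_sq
  have hcrit : 2 * inner ℝ (γ t0 - C) (v t0) = 0 := by
    have hmx : IsLocalMax (fun t => ‖γ t - C‖ ^ 2) t0 := by
      filter_upwards [hz] with t ht
      rw [hgt0]; exact hg1 t ht.1 ht.2
    exact hmx.hasDerivAt_eq_zero (hgd t0 ht0')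
  obtain ⟨ε, hε, hball⟩ := Metric.eventually_nhds_iff.1 hz
  set a := t0 - ε / 2 with ha
  have hat : a < t0 := by linarith
  have hnb : ∀ t ∈ Icc a t0, t ∈ Ioo 0 s ∧ M < γ t 2 := by
    intro t ht
    apply hball
    rw [Real.dist_eq, abs_lt]
    constructor <;> linarith [ht.1, ht.2]
  have hwc : ContinuousOn (fun t => 2 * inner ℝ (γ t - C) (v t)) (Icc 0 s) :=
    continuousOn_const.mul ((hγc.sub continuousOn_const).inner hvc)
  have hw : ∀ t ∈ Icc a t0, 2 * inner ℝ (γ t - C) (v t) ≤ 0 := by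
    intro t ht
    rw [← hcrit]
    apply aux_mono F t t0 (fun t => 2 * inner ℝ (γ t - C) (v t)) ht.2
    · apply hwc.mono
      intro u hu
      exact Ioo_subset_Icc_self (hnb u ⟨ht.1.trans hu.1, hu.2⟩).1
    · intro u hu huF
      obtain ⟨hu1, hu2⟩ := hnb u ⟨ht.1.trans hu.1.le, hu.2.le⟩
      obtain ⟨d, hd, hdn⟩ := hF u (Ioo_subset_Icc_self hu1) huF
      have hd' : HasDerivAt v d u := hd.hasDerivAt (Icc_mem_nhds hu1.1 hu1.2)
      refine ⟨_, (((hγd u hu1).sub_const C).inner ℝ hd').const_mul 2, ?_⟩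
      have h1 : inner ℝ (v u) (v u) = (1 : ℝ) := by
        rw [real_inner_self_eq_norm_sq, hK.unitSpeed u (Ioo_subset_Icc_self hu1)]; norm_num
      have h2 := abs_le.1 (abs_real_inner_le_norm (γ u - C) d)
      have h3 : ‖γ u - C‖ ≤ 1 := by
        have := hg1 u hu1 hu2
        nlinarith [norm_nonneg (γ u - C)]
      have h4 : ‖γ u - C‖ * ‖d‖ ≤ 1 := mul_le_one₀ h3 (norm_nonneg _) hdn
      rw [h1]; linarith [h2.1]
  have hga : 1 ≤ ‖γ a - C‖ ^ 2 := by
    have := aux_mono ∅ a t0 (fun t => - ‖γ t - C‖ ^ 2) hat.le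
      (fun u hu => (hgd u (hnb u hu).1).continuousAt.neg.continuousWithinAt)
      (fun u hu _ => ⟨_, (hgd u (hnb u (Ioo_subset_Icc_self hu)).1).neg,
        by linarith [hw u (Ioo_subset_Icc_self hu)]⟩)
    simp only [hgt0] at this
    linarith
  obtain ⟨ha1, ha2⟩ := hnb a ⟨le_rfl, hat.le⟩
  have hfa : f a = M := by
    have h1 := le_antisymm (hg1 a ha1 ha2) hga
    rw [hg] at h1
    have h2 : 1 - ((γ a 0) ^ 2 + (γ a 1) ^ 2) = (γ a 2 - M) ^ 2 := by linarith
    simp only [hf]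
    rw [h2, Real.sqrt_sq (by linarith)]; ring
  have := hleast ⟨Ioo_subset_Icc_self ha1, hfa⟩
  linarith

end
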